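/- arXiv:2106.10128 — 2 statements merged into one kernel-verified Lean document; each statement's English description precedes it below -/
import Mathlib

section
/- (Uniqueness of flow) Let X be an exponentiable Lie–Bäcklund field on J^∞(ℝ^n,ℝ^m), and suppose Φ_t and Ψ_t are both flows of X in the sense of exponentiability. Then Φ_t = Ψ_t for all t (all corresponding components coincide). -/
open scoped BigOperators

/-- Multiindices in `n` variables. -/
abbrev MI (n : ℕ) := Fin n → ℕ

/-- The infinite jet space `J^∞(ℝ^n, ℝ^m)`: coordinates `x_i` and `y^α_L`. -/
abbrev Jet (n m : ℕ) := (Fin n → ℝ) × (Fin m × MI n → ℝ)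

/-- Degree `|α|` of a multiindex. -/
def mdeg {n : ℕ} (α : MI n) : ℕ := ∑ j, α j

/-- Partial derivative with respect to the coordinate `x_i`. -/
noncomputable def pdX {n m : ℕ} (i : Fin n) (F : Jet n m → ℝ) : Jet n m → ℝ :=
  fun p => deriv (fun t => F (Function.update p.1 i t, p.2)) (p.1 i)

/-- Partial derivative with respect to the coordinate `y^α_L`, `q = (L, α)`. -/
noncomputable def pdY {n m : ℕ} (q : Fin m × MI n) (F : Jet n m → ℝ) : Jet n m → ℝ :=
  fun p => deriv (fun t => F (p.1, Function.update p.2 q t)) (p.2 q)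

/-- A function on `J^∞(ℝ^n,ℝ^m)` is admissible if it is a `C^∞` function of
finitely many of the coordinates. -/
def Admissible {n m : ℕ} (F : Jet n m → ℝ) : Prop :=
  ∃ (S : Finset (Fin m × MI n)) (g : ((Fin n → ℝ) × (↥S → ℝ)) → ℝ),
    ContDiff ℝ (⊤ : ℕ∞) g ∧ ∀ p : Jet n m, F p = g (p.1, fun a => p.2 a.1)

/-- The total derivative `D^i = ∂/∂x_i + Σ_{L,α} y^{α+i}_L ∂/∂y^α_L`. -/
noncomputable def totD {n m : ℕ} (i : Fin n) (F : Jet n m → ℝ) : Jet n m → ℝ :=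
  fun p => pdX i F p +
    ∑ᶠ q : Fin m × MI n, p.2 (q.1, q.2 + Pi.single i 1) * pdY q F p

/-- The components `ξ, η` form a Lie–Bäcklund field on `J^∞(ℝ^n,ℝ^m)`: they are
admissible and satisfy `η^{α+k}_L = D^k η^α_L − Σ_i y^{α+i}_L D^k ξ_i` for every
unit multiindex `k`. -/
def IsLB {n m : ℕ} (ξ : Fin n → Jet n m → ℝ) (η : Fin m × MI n → Jet n m → ℝ) : Prop :=
  (∀ i, Admissible (ξ i)) ∧ (∀ q, Admissible (η q)) ∧
    ∀ (L : Fin m) (α : MI n) (k : Fin n), η (L, α + Pi.single k 1) =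
      fun p => totD k (η (L, α)) p -
        ∑ i, p.2 (L, α + Pi.single i 1) * totD k (ξ i) p

/-- A family `F t` of functions, each an admissible function of the coordinates, with
the finite set of relevant coordinates independent of `t` and `C^∞` joint dependence. -/
def AdmissibleT {n m : ℕ} (F : ℝ → Jet n m → ℝ) : Prop :=
  ∃ (S : Finset (Fin m × MI n)) (g : ℝ × (Fin n → ℝ) × (↥S → ℝ) → ℝ),
    ContDiff ℝ (⊤ : ℕ∞) g ∧ ∀ (t : ℝ) (p : Jet n m), F t p = g (t, p.1, fun a => p.2 a.1)

/-- `Φ` is a flow of the field with components `ξ, η`, in the sense of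
exponentiability. -/
def IsFlowOf {n m : ℕ} (ξ : Fin n → Jet n m → ℝ) (η : Fin m × MI n → Jet n m → ℝ)
    (Φ : ℝ → Jet n m → Jet n m) : Prop :=
  (∀ i, AdmissibleT fun t p => (Φ t p).1 i) ∧
  (∀ q, AdmissibleT fun t p => (Φ t p).2 q) ∧
  Φ 0 = id ∧ (∀ s t : ℝ, Φ t ∘ Φ s = Φ (t + s)) ∧
  (∀ i p, deriv (fun t => (Φ t p).1 i) 0 = ξ i p) ∧
  (∀ q p, deriv (fun t => (Φ t p).2 q) 0 = η q p)

/-- The coordinates of a jet in `S`, together with the base coordinates. -/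
def jetRestrict {n m : ℕ} (S : Finset (Fin m × MI n)) (p : Jet n m) :
    (Fin n → ℝ) × (↥S → ℝ) :=
  (p.1, fun a => p.2 a.1)

theorem AdmissibleT.differentiableAt {n m : ℕ} {F : ℝ → Jet n m → ℝ} (hF : AdmissibleT F)
    (p : Jet n m) (t : ℝ) : DifferentiableAt ℝ (fun t => F t p) t := by
  obtain ⟨S, g, hg, hFg⟩ := hF
  simp only [hFg]
  have hd : Differentiable ℝ g := hg.differentiable (by simp)
  exact (hd _).comp t (differentiableAt_id.prodMk (differentiableAt_const _))

theorem IsFlowOf.add_apply {n m : ℕ} {ξ : Fin n → Jet n m → ℝ}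
    {η : Fin m × MI n → Jet n m → ℝ} {Φ : ℝ → Jet n m → Jet n m} (hΦ : IsFlowOf ξ η Φ)
    (t s : ℝ) (p : Jet n m) : Φ (t + s) p = Φ t (Φ s p) :=
  (congrFun (hΦ.2.2.2.1 s t) p).symm

theorem IsFlowOf.zero_apply {n m : ℕ} {ξ : Fin n → Jet n m → ℝ}
    {η : Fin m × MI n → Jet n m → ℝ} {Φ : ℝ → Jet n m → Jet n m} (hΦ : IsFlowOf ξ η Φ)
    (p : Jet n m) : Φ 0 p = p :=
  congrFun hΦ.2.2.1 p

/-- Finitely many components of an orbit of a flow form an integral curve of the field. -/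
theorem IsFlowOf.hasDerivAt_jetRestrict {n m : ℕ} {ξ : Fin n → Jet n m → ℝ}
    {η : Fin m × MI n → Jet n m → ℝ} {Φ : ℝ → Jet n m → Jet n m} (hΦ : IsFlowOf ξ η Φ)
    (S : Finset (Fin m × MI n)) (p : Jet n m) (t : ℝ) :
    HasDerivAt (fun s => jetRestrict S (Φ s p))
      ((fun i => ξ i (Φ t p), fun a => η a.1 (Φ t p)) : (Fin n → ℝ) × (↥S → ℝ)) t := by
  have at_zero : ∀ q : Jet n m, HasDerivAt (fun s => jetRestrict S (Φ s q))
      ((fun i => ξ i q, fun a => η a.1 q) : (Fin n → ℝ) × (↥S → ℝ)) 0 := by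
    intro q
    refine HasDerivAt.prodMk (hasDerivAt_pi.2 fun i => ?_) (hasDerivAt_pi.2 fun a => ?_)
    · rw [← hΦ.2.2.2.2.1 i q]
      exact ((hΦ.1 i).differentiableAt q 0).hasDerivAt
    · rw [← hΦ.2.2.2.2.2 a.1 q]
      exact ((hΦ.2.1 a.1).differentiableAt q 0).hasDerivAt
  have hshift := at_zero (Φ t p)
  rw [← sub_self t] at hshift
  refine (hshift.comp_sub_const t t).congr_of_eventuallyEq (Filter.Eventually.of_forall fun s => ?_)
  simp only [← hΦ.add_apply, sub_add_cancel]

/-- A function pulled back by one flow of a field is constant along the reversed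
composition with another flow of the same field. -/
theorem IsFlowOf.apply_neg_comp {n m : ℕ} {ξ : Fin n → Jet n m → ℝ}
    {η : Fin m × MI n → Jet n m → ℝ} {Φ Ψ : ℝ → Jet n m → Jet n m}
    (hΦ : IsFlowOf ξ η Φ) (hΨ : IsFlowOf ξ η Ψ) {F : Jet n m → ℝ}
    (hF : AdmissibleT fun t p => F (Ψ t p)) (t : ℝ) (p : Jet n m) :
    F (Ψ (-t) (Φ t p)) = F p := by
  obtain ⟨S, g, hg, hFg⟩ := hF
  have hd : Differentiable ℝ g := hg.differentiable (by simp)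
  replace hFg : ∀ (s : ℝ) (q : Jet n m), F (Ψ s q) = g (s, jetRestrict S q) := hFg
  have infinitesimal : ∀ (s : ℝ) (q : Jet n m),
      fderiv ℝ g (s, jetRestrict S q) (1, 0) =
        fderiv ℝ g (s, jetRestrict S q) (0, (fun i => ξ i q, fun a => η a.1 q)) := by
    intro s q
    have hleft : HasDerivAt (fun h => g (s + h, jetRestrict S q))
        (fderiv ℝ g (s, jetRestrict S q) (1, 0)) 0 := by
      have hcurve := ((hasDerivAt_id (0 : ℝ)).const_add s).prodMk
        (hasDerivAt_const (0 : ℝ) (jetRestrict S q))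
      refine HasFDerivAt.comp_hasDerivAt (0 : ℝ) ?_ hcurve
      simpa using (hd (s, jetRestrict S q)).hasFDerivAt
    have hright : HasDerivAt (fun h => g (s, jetRestrict S (Ψ h q)))
        (fderiv ℝ g (s, jetRestrict S q) (0, (fun i => ξ i q, fun a => η a.1 q))) 0 := by
      have hcurve := (hasDerivAt_const (0 : ℝ) s).prodMk (hΨ.hasDerivAt_jetRestrict S q 0)
      rw [hΨ.zero_apply] at hcurve
      refine HasFDerivAt.comp_hasDerivAt (0 : ℝ) ?_ hcurve
      simpa only [hΨ.zero_apply] using (hd (s, jetRestrict S q)).hasFDerivAt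
    refine hleft.unique (hright.congr_of_eventuallyEq (Filter.Eventually.of_forall fun h => ?_))
    simp only [← hFg, hΨ.add_apply]
  have hderiv : ∀ s : ℝ, HasDerivAt (fun s => F (Ψ (-s) (Φ s p))) 0 s := by
    intro s
    have hcurve := (hasDerivAt_neg s).prodMk (hΦ.hasDerivAt_jetRestrict S p s)
    have hcomp := (hd (-s, jetRestrict S (Φ s p))).hasFDerivAt.comp_hasDerivAt s hcurve
    simp only [hFg]
    have hzero := sub_eq_zero.2 (infinitesimal (-s) (Φ s p)).symm
    rw [← map_sub, Prod.mk_sub_mk, zero_sub, sub_zero] at hzero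
    rw [hzero] at hcomp
    exact hcomp
  have hconst := is_const_of_deriv_eq_zero (fun s => (hderiv s).differentiableAt)
    (fun s => (hderiv s).deriv) t 0
  simpa only [neg_zero, hΦ.zero_apply, hΨ.zero_apply] using hconst

/-- Theorem 3, uniqueness of flow: two flows of an exponentiable
Lie–Bäcklund field on `J^∞(ℝ^n,ℝ^m)` coincide. -/
theorem uniqueness_of_flow {n m : ℕ}
    (ξ : Fin n → Jet n m → ℝ) (η : Fin m × MI n → Jet n m → ℝ)
    (hLB : IsLB ξ η)
    (Φ Ψ : ℝ → Jet n m → Jet n m)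
    (hΦ : IsFlowOf ξ η Φ) (hΨ : IsFlowOf ξ η Ψ) :
    Φ = Ψ := by
  funext t p
  have hinv : Ψ (-t) (Φ t p) = p :=
    Prod.ext (funext fun i => hΦ.apply_neg_comp hΨ (F := fun q => q.1 i) (hΨ.1 i) t p)
      (funext fun a => hΦ.apply_neg_comp hΨ (F := fun q => q.2 a) (hΨ.2.1 a) t p)
  calc Φ t p = Ψ (t + -t) (Φ t p) := by rw [add_neg_cancel, hΨ.zero_apply]
    _ = Ψ t p := by rw [hΨ.add_apply, hinv]
end

section
/- Let X = Σ_i ξ_i ∂/∂x_i + Σ_{L,α} η^α_L ∂/∂y^α_L be a Lie–Bäcklund field on J^∞(ℝ^n,ℝ^m) with admissible components, and suppose the set B = {(M,β) : ∃i with ∂ξ_i/∂y^β_M ≠ 0, or ∃L with ∂η^0_L/∂y^β_M ≠ 0} is finite; set |B| = max{|β| : (M,β) ∈ B}. Then for every (L,α) and every (M,γ) with |γ| > |α| + |B|, one has ∂η^α_L/∂y^γ_M = 0. Moreover, for each k ≥ |B| and each (L,α) with |α| ≤ k, the component η^α_L is a polynomial in the variables y^γ_M with |γ| > k, whose coefficients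 are smooth functions of x_1,…,x_n and of the variables y^γ_M with |γ| ≤ k. -/
open scoped BigOperators

/-- `F` depends only on `x` and the coordinates `y^β_M` with `|β| ≤ k`. -/
def DependsOnOrderLE {n m : ℕ} (k : ℕ) (F : Jet n m → ℝ) : Prop :=
  ∀ p q : Jet n m, p.1 = q.1 →
    (∀ (L : Fin m) (β : MI n), mdeg β ≤ k → p.2 (L, β) = q.2 (L, β)) → F p = F q

open Function

section

variable {n m : ℕ}

lemma mdeg_add_single (α : MI n) (k : Fin n) : mdeg (α + Pi.single k 1) = mdeg α + 1 := by
  simp [mdeg, Finset.sum_add_distrib]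

/-- Induction on multiindices by increasing one slot at a time. -/
lemma MI.induction {P : MI n → Prop} (zero : P 0)
    (step : ∀ α k, P α → P (α + Pi.single k 1)) (α : MI n) : P α := by
  induction h : mdeg α generalizing α with
  | zero =>
    have : α = 0 := by
      funext j
      exact (Finset.sum_eq_zero_iff.mp h) j (Finset.mem_univ j)
    exact this ▸ zero
  | succ N ih =>
    obtain ⟨k, hk⟩ : ∃ k, α k ≠ 0 := by
      by_contra! hα
      simp [mdeg, hα] at h
    have hα : α = Function.update α k (α k - 1) + Pi.single k 1 := by
      funext j
      rcases eq_or_ne j k with rfl | hj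
      · simp; omega
      · simp [hj]
    rw [hα] at h ⊢
    rw [mdeg_add_single] at h
    exact step _ k (ih _ (by omega))

namespace Admissible

lemma contDiff_lift {S U : Finset (Fin m × MI n)} (h : S ⊆ U)
    {g : ((Fin n → ℝ) × (↥S → ℝ)) → ℝ} (hg : ContDiff ℝ (⊤ : ℕ∞) g) :
    ContDiff ℝ (⊤ : ℕ∞) (fun z : (Fin n → ℝ) × (↥U → ℝ) =>
      g (z.1, fun a => z.2 ⟨a.1, h a.2⟩)) := by
  fun_prop

lemma add {F G : Jet n m → ℝ} (hF : Admissible F) (hG : Admissible G) : Admissible (F + G) := by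
  classical
  obtain ⟨S, f, hf, hF⟩ := hF
  obtain ⟨U, g, hg, hG⟩ := hG
  refine ⟨S ∪ U, _, (contDiff_lift Finset.subset_union_left hf).add
    (contDiff_lift Finset.subset_union_right hg), fun p => ?_⟩
  simp [hF, hG]

lemma mul {F G : Jet n m → ℝ} (hF : Admissible F) (hG : Admissible G) : Admissible (F * G) := by
  classical
  obtain ⟨S, f, hf, hF⟩ := hF
  obtain ⟨U, g, hg, hG⟩ := hG
  refine ⟨S ∪ U, _, (contDiff_lift Finset.subset_union_left hf).mul
    (contDiff_lift Finset.subset_union_right hg), fun p => ?_⟩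
  simp [hF, hG]

lemma const (r : ℝ) : Admissible (fun _ : Jet n m => r) :=
  ⟨∅, fun _ => r, contDiff_const, fun _ => rfl⟩

lemma coord (q : Fin m × MI n) : Admissible (fun p : Jet n m => p.2 q) :=
  ⟨{q}, fun z => z.2 ⟨q, by simp⟩, by fun_prop, fun _ => rfl⟩

lemma differentiable_x {F : Jet n m → ℝ} (hF : Admissible F) (i : Fin n) (p : Jet n m) :
    Differentiable ℝ (fun t => F (update p.1 i t, p.2)) := by
  obtain ⟨S, g, hg, hF⟩ := hF
  simp only [hF]
  have hg' : Differentiable ℝ g := hg.differentiable (by simp)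
  have hu : Differentiable ℝ (fun t : ℝ => update p.1 i t) :=
    fun t => (hasDerivAt_update p.1 i t).differentiableAt
  fun_prop

lemma differentiable_y {F : Jet n m → ℝ} (hF : Admissible F) (q : Fin m × MI n) (p : Jet n m) :
    Differentiable ℝ (fun t => F (p.1, update p.2 q t)) := by
  obtain ⟨S, g, hg, hF⟩ := hF
  simp only [hF]
  have hg' : Differentiable ℝ g := hg.differentiable (by simp)
  have hu : Differentiable ℝ (fun (t : ℝ) (a : ↥S) => update p.2 q t a.1) := by
    rw [differentiable_pi]
    intro a
    rcases eq_or_ne a.1 q with h | h <;> simp [h]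
  exact hg'.comp ((differentiable_const p.1).prodMk hu)

lemma pdX {F : Jet n m → ℝ} (hF : Admissible F) (i : Fin n) : Admissible (pdX i F) := by
  obtain ⟨S, g, hg, hF⟩ := hF
  refine ⟨S, fun z => fderiv ℝ g z (Pi.single i 1, 0), ?_, fun p => ?_⟩
  · exact (hg.fderiv_right (m := (⊤ : ℕ∞)) (by simp)).clm_apply contDiff_const
  · simp only [_root_.pdX, hF]
    have hg' := (hg.differentiable (by simp) (p.1, fun a : ↥S => p.2 a.1)).hasFDerivAt
    have hu : HasDerivAt (fun t : ℝ => (update p.1 i t, fun a : ↥S => p.2 a.1))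
        (Pi.single i 1, 0) (p.1 i) :=
      (hasDerivAt_update p.1 i (p.1 i)).prodMk (hasDerivAt_const _ _)
    refine (HasFDerivAt.comp_hasDerivAt (p.1 i) (l := g) ?_ hu).deriv
    simpa using hg'

lemma exists_pdY_eq_zero {F : Jet n m → ℝ} (hF : Admissible F) :
    ∃ S : Finset (Fin m × MI n), (∀ q ∉ S, _root_.pdY q F = 0) ∧
      ∀ p p' : Jet n m, p.1 = p'.1 → (∀ q ∈ S, p.2 q = p'.2 q) → F p = F p' := by
  obtain ⟨S, g, hg, hF⟩ := hF
  refine ⟨S, fun q hq => ?_, fun p p' h1 h2 => ?_⟩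
  · funext p
    have : ∀ t, (fun a : ↥S => update p.2 q t a.1) = fun a => p.2 a.1 := by
      intro t
      funext a
      exact update_of_ne (ne_of_mem_of_not_mem a.2 hq) _ _
    simp [_root_.pdY, hF, this]
  · rw [hF, hF, h1]
    congr 2
    funext a
    exact h2 _ a.2

lemma pdY {F : Jet n m → ℝ} (hF : Admissible F) (q : Fin m × MI n) : Admissible (pdY q F) := by
  classical
  obtain ⟨S, g, hg, hF⟩ := hF
  refine ⟨S, fun z => fderiv ℝ g z (0, fun a => if a.1 = q then 1 else 0), ?_, fun p => ?_⟩
  · exact (hg.fderiv_right (m := (⊤ : ℕ∞)) (by simp)).clm_apply contDiff_const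
  · simp only [_root_.pdY, hF]
    have hg' := (hg.differentiable (by simp) (p.1, fun a : ↥S => p.2 a.1)).hasFDerivAt
    have hu : HasDerivAt (fun t : ℝ => (p.1, fun a : ↥S => update p.2 q t a.1))
        (0, fun a => if a.1 = q then 1 else 0) (p.2 q) := by
      refine (hasDerivAt_const _ _).prodMk (hasDerivAt_pi.mpr fun a => ?_)
      rcases eq_or_ne a.1 q with h | h
      · simpa [h] using hasDerivAt_id' (p.2 q)
      · simpa [h] using hasDerivAt_const (p.2 q) (p.2 a.1)
    refine (HasFDerivAt.comp_hasDerivAt (p.2 q) (l := g) ?_ hu).deriv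
    simpa using hg'

/-- An admissible function with vanishing derivatives in the coordinates of order `> k`
depends only on the coordinates of order `≤ k`. -/
lemma dependsOnOrderLE {F : Jet n m → ℝ} (hF : Admissible F) {k : ℕ}
    (h : ∀ q : Fin m × MI n, k < mdeg q.2 → _root_.pdY q F = 0) : DependsOnOrderLE k F := by
  classical
  intro p p' hx hy
  have key : ∀ U : Finset (Fin m × MI n),
      F (p.1, fun q => if q ∈ U then p'.2 q else p.2 q) = F p := by
    intro U
    induction U using Finset.induction_on with
    | empty => simp
    | insert u U hu ih =>
      rw [← ih]
      set y : Fin m × MI n → ℝ := fun q => if q ∈ U then p'.2 q else p.2 q with hydef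
      have hins : (fun q => if q ∈ insert u U then p'.2 q else p.2 q) = update y u (p'.2 u) := by
        funext q
        rcases eq_or_ne q u with rfl | hq
        · simp
        · simp [hq, hydef]
      have hyu : y = update y u (p.2 u) := by
        rw [eq_comm, update_eq_self_iff]
        simp [hydef, hu]
      rw [hins]
      by_cases hk : mdeg u.2 ≤ k
      · rw [← hy u.1 u.2 hk, ← hyu]
      · conv_rhs => rw [hyu]
        refine is_const_of_deriv_eq_zero (hF.differentiable_y u (p.1, y)) (fun t => ?_) _ _
        have := congrFun (h u (not_le.mp hk)) (p.1, update y u t)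
        simpa [_root_.pdY] using this
  obtain ⟨S, -, hS⟩ := hF.exists_pdY_eq_zero
  rw [← key S]
  exact hS _ _ hx fun q hq => by simp [hq]

end Admissible

lemma pdX_add {F G : Jet n m → ℝ} (hF : Admissible F) (hG : Admissible G) (i : Fin n) :
    pdX i (F + G) = pdX i F + pdX i G :=
  funext fun p => deriv_fun_add (hF.differentiable_x i p _) (hG.differentiable_x i p _)

lemma pdY_add {F G : Jet n m → ℝ} (hF : Admissible F) (hG : Admissible G) (q : Fin m × MI n) :
    pdY q (F + G) = pdY q F + pdY q G :=
  funext fun p => deriv_fun_add (hF.differentiable_y q p _) (hG.differentiable_y q p _)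

lemma pdX_mul {F G : Jet n m → ℝ} (hF : Admissible F) (hG : Admissible G) (i : Fin n) :
    pdX i (F * G) = pdX i F * G + F * pdX i G := by
  funext p
  simpa [pdX] using deriv_fun_mul (hF.differentiable_x i p (p.1 i)) (hG.differentiable_x i p (p.1 i))

lemma pdY_mul {F G : Jet n m → ℝ} (hF : Admissible F) (hG : Admissible G) (q : Fin m × MI n) :
    pdY q (F * G) = pdY q F * G + F * pdY q G := by
  funext p
  simpa [pdY] using deriv_fun_mul (hF.differentiable_y q p (p.2 q)) (hG.differentiable_y q p (p.2 q))

namespace DependsOnOrderLE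

variable {k : ℕ} {F : Jet n m → ℝ}

lemma mono {l : ℕ} (h : DependsOnOrderLE k F) (hkl : k ≤ l) : DependsOnOrderLE l F :=
  fun p p' hx hy => h p p' hx fun L β hβ => hy L β (hβ.trans hkl)

lemma pdY_eq_zero (h : DependsOnOrderLE k F) {q : Fin m × MI n} (hq : k < mdeg q.2) :
    pdY q F = 0 := by
  funext p
  have : ∀ t, F (p.1, update p.2 q t) = F p := fun t => h _ _ rfl fun L β hβ =>
    update_of_ne (by rintro rfl; exact absurd hq (not_lt.mpr hβ)) _ _
  simp [pdY, this]

lemma pdX (h : DependsOnOrderLE k F) (i : Fin n) : DependsOnOrderLE k (pdX i F) := by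
  intro p p' hx hy
  simp only [_root_.pdX, hx]
  congr 1
  funext t
  exact h _ _ rfl hy

lemma pdY (h : DependsOnOrderLE k F) (q : Fin m × MI n) : DependsOnOrderLE k (pdY q F) := by
  intro p p' hx hy
  by_cases hq : k < mdeg q.2
  · simp [h.pdY_eq_zero hq]
  · simp only [_root_.pdY, hy q.1 q.2 (not_lt.mp hq)]
    congr 1
    funext t
    refine h _ _ hx fun L β hβ => ?_
    by_cases hq' : (L, β) = q
    · simp [hq']
    · simp [hq', hy L β hβ]

lemma totD (h : DependsOnOrderLE k F) (i : Fin n) : DependsOnOrderLE (k + 1) (totD i F) := by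
  intro p p' hx hy
  have hy' : ∀ L β, mdeg β ≤ k → p.2 (L, β) = p'.2 (L, β) := fun L β hβ => hy L β (by omega)
  simp only [_root_.totD, h.pdX i p p' hx hy']
  congr 1
  refine finsum_congr fun q => ?_
  by_cases hq : k < mdeg q.2
  · simp [h.pdY_eq_zero hq]
  · rw [h.pdY q p p' hx hy', hy _ _ (by rw [mdeg_add_single]; omega)]

end DependsOnOrderLE

/-- The algebra of smooth functions of `x` and the coordinates of order `≤ k`. -/
def lowAlgebra (n m k : ℕ) : Subalgebra ℝ (Jet n m → ℝ) where
  carrier := {F | Admissible F ∧ DependsOnOrderLE k F}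
  mul_mem' hF hG := ⟨hF.1.mul hG.1, fun p p' hx hy => by
    simp [hF.2 p p' hx hy, hG.2 p p' hx hy]⟩
  add_mem' hF hG := ⟨hF.1.add hG.1, fun p p' hx hy => by
    simp [hF.2 p p' hx hy, hG.2 p p' hx hy]⟩
  algebraMap_mem' r := ⟨Admissible.const r, fun _ _ _ _ => rfl⟩

/-- The coordinate function `y_q` if its order exceeds `k`, and `0` otherwise. -/
noncomputable def highCoord (n m k : ℕ) (q : Fin m × MI n) : Jet n m → ℝ :=
  if k < mdeg q.2 then fun p => p.2 q else 0

/-- The algebra of polynomials in the coordinates of order `> k` with coefficients in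
`lowAlgebra n m k`. -/
noncomputable def polyAlgebra (n m k : ℕ) : Subalgebra (lowAlgebra n m k) (Jet n m → ℝ) :=
  Algebra.adjoin (lowAlgebra n m k) (Set.range (highCoord n m k))

lemma mem_polyAlgebra_of_low {k : ℕ} {F : Jet n m → ℝ} (hF : Admissible F)
    (h : DependsOnOrderLE k F) : F ∈ polyAlgebra n m k :=
  (polyAlgebra n m k).algebraMap_mem (⟨F, hF, h⟩ : lowAlgebra n m k)

lemma coord_mem_polyAlgebra (k : ℕ) (q : Fin m × MI n) :
    (fun p : Jet n m => p.2 q) ∈ polyAlgebra n m k := by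
  by_cases hq : k < mdeg q.2
  · exact Algebra.subset_adjoin ⟨q, by simp [highCoord, hq]⟩
  · exact mem_polyAlgebra_of_low (Admissible.coord q) fun p p' _ hy => hy _ _ (not_lt.mp hq)

lemma highCoord_admissible (k : ℕ) (q : Fin m × MI n) : Admissible (highCoord n m k q) := by
  unfold highCoord
  split_ifs
  · exact Admissible.coord q
  · exact Admissible.const 0

lemma const_mem_polyAlgebra (k : ℕ) (r : ℝ) : (fun _ : Jet n m => r) ∈ polyAlgebra n m k :=
  mem_polyAlgebra_of_low (Admissible.const r) fun _ _ _ _ => rfl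

lemma pdX_highCoord (k : ℕ) (i : Fin n) (q : Fin m × MI n) : pdX i (highCoord n m k q) = 0 := by
  funext p
  unfold highCoord
  split_ifs <;> simp [pdX]

lemma pdY_highCoord_mem (k : ℕ) (q q' : Fin m × MI n) :
    pdY q' (highCoord n m k q) ∈ polyAlgebra n m k := by
  by_cases hq : k < mdeg q.2
  · rcases eq_or_ne q q' with rfl | h
    · convert const_mem_polyAlgebra (n := n) (m := m) k 1 using 1
      funext p
      simp [pdY, highCoord, hq]
    · convert const_mem_polyAlgebra (n := n) (m := m) k 0 using 1
      funext p
      simp [pdY, highCoord, hq, h]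
  · convert const_mem_polyAlgebra (n := n) (m := m) k 0 using 1
    funext p
    simp [pdY, highCoord, hq]

lemma polyAlgebra_derivatives {k : ℕ} {F : Jet n m → ℝ} (hF : F ∈ polyAlgebra n m k) :
    Admissible F ∧ (∀ i, pdX i F ∈ polyAlgebra n m k) ∧ ∀ q, pdY q F ∈ polyAlgebra n m k := by
  induction hF using Algebra.adjoin_induction with
  | mem F hF =>
    obtain ⟨q, rfl⟩ := hF
    exact ⟨highCoord_admissible k q, fun i => by rw [pdX_highCoord]; exact zero_mem _,
      pdY_highCoord_mem k q⟩
  | algebraMap F =>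
    obtain ⟨F, hF, h⟩ := F
    exact ⟨hF, fun i => mem_polyAlgebra_of_low (hF.pdX i) (h.pdX i),
      fun q => mem_polyAlgebra_of_low (hF.pdY q) (h.pdY q)⟩
  | add F G _ _ hF hG =>
    refine ⟨hF.1.add hG.1, fun i => ?_, fun q => ?_⟩
    · rw [pdX_add hF.1 hG.1]
      exact add_mem (hF.2.1 i) (hG.2.1 i)
    · rw [pdY_add hF.1 hG.1]
      exact add_mem (hF.2.2 q) (hG.2.2 q)
  | mul F G hF' hG' hF hG =>
    refine ⟨hF.1.mul hG.1, fun i => ?_, fun q => ?_⟩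
    · rw [pdX_mul hF.1 hG.1]
      exact add_mem (mul_mem (hF.2.1 i) hG') (mul_mem hF' (hG.2.1 i))
    · rw [pdY_mul hF.1 hG.1]
      exact add_mem (mul_mem (hF.2.2 q) hG') (mul_mem hF' (hG.2.2 q))

lemma totD_mem_polyAlgebra {k : ℕ} {F : Jet n m → ℝ} (hF : F ∈ polyAlgebra n m k) (i : Fin n) :
    totD i F ∈ polyAlgebra n m k := by
  obtain ⟨hadm, hX, hY⟩ := polyAlgebra_derivatives hF
  obtain ⟨S, hS, -⟩ := hadm.exists_pdY_eq_zero
  have : totD i F = pdX i F +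
      ∑ q ∈ S, (fun p : Jet n m => p.2 (q.1, q.2 + Pi.single i 1)) * pdY q F := by
    funext p
    simp only [totD, Pi.add_apply, Finset.sum_apply, Pi.mul_apply]
    congr 1
    refine finsum_eq_sum_of_support_subset _ fun q hq => ?_
    by_contra hqS
    exact hq (by simp [hS q hqS])
  rw [this]
  exact add_mem (hX i) (sum_mem fun q _ => mul_mem (coord_mem_polyAlgebra k _) (hY q))

lemma exists_polynomial_of_mem_polyAlgebra {k : ℕ} {F : Jet n m → ℝ}
    (hF : F ∈ polyAlgebra n m k) :
    ∃ (T : Finset ((Fin m × MI n) →₀ ℕ)) (c : ((Fin m × MI n) →₀ ℕ) → Jet n m → ℝ),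
      (∀ μ ∈ T, ∀ q ∈ μ.support, mdeg q.2 > k) ∧
      (∀ μ ∈ T, Admissible (c μ) ∧ DependsOnOrderLE k (c μ)) ∧
      ∀ p : Jet n m, F p = ∑ μ ∈ T, c μ p * μ.prod (fun q e => p.2 q ^ e) := by
  classical
  rw [polyAlgebra, Algebra.adjoin_range_eq_range_aeval] at hF
  obtain ⟨P, rfl⟩ := hF
  refine ⟨P.support.filter fun μ => ∀ q ∈ μ.support, mdeg q.2 > k,
    fun μ => (P.coeff μ).1, fun μ hμ => (Finset.mem_filter.mp hμ).2,
    fun μ _ => (P.coeff μ).2, fun p => ?_⟩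
  have hsum : (MvPolynomial.aeval (highCoord n m k) P) p =
      ∑ μ ∈ P.support, (P.coeff μ).1 p *
        μ.prod (fun q e => highCoord n m k q p ^ e) := by
    rw [MvPolynomial.aeval_def, MvPolynomial.eval₂_eq]
    simp [Finset.sum_apply, Finset.prod_apply, Finsupp.prod]
  refine hsum.trans ?_
  rw [Finset.sum_filter]
  refine Finset.sum_congr rfl fun μ _ => ?_
  split_ifs with hμ
  · congr 1
    refine Finset.prod_congr rfl fun q hq => ?_
    have : k < mdeg q.2 := hμ q hq
    simp [highCoord, this]
  · push Not at hμ
    obtain ⟨q, hq, hqk⟩ := hμ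
    have : μ.prod (fun q e => highCoord n m k q p ^ e) = 0 := by
      refine Finset.prod_eq_zero hq ?_
      simp [highCoord, not_lt.mpr hqk, Finsupp.mem_support_iff.mp hq]
    rw [this, mul_zero]

end

/-- for a Lie–Bäcklund field whose set `B` of coordinates on which the
principal components depend is finite, with `|B| = max{|β| : (M,β) ∈ B}`, one has
`∂η^α_L/∂y^γ_M = 0` whenever `|γ| > |α| + |B|`; moreover for `k ≥ |B|` and `|α| ≤ k`,
`η^α_L` is a polynomial in the variables `y^γ_M` with `|γ| > k` whose coefficients are
smooth functions of `x` and the variables `y^γ_M` with `|γ| ≤ k`. -/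
theorem lb_components_polynomial {n m : ℕ}
    (ξ : Fin n → Jet n m → ℝ) (η : Fin m × MI n → Jet n m → ℝ)
    (hLB : IsLB ξ η)
    (B : Finset (Fin m × MI n))
    (hB : ∀ q : Fin m × MI n,
      q ∈ B ↔ ((∃ i, pdY q (ξ i) ≠ 0) ∨ (∃ L : Fin m, pdY q (η (L, 0)) ≠ 0)))
    (bB : ℕ) (hbB : bB = B.sup fun q => mdeg q.2) :
    (∀ (L : Fin m) (α : MI n) (M : Fin m) (γ : MI n),
        mdeg γ > mdeg α + bB → pdY (M, γ) (η (L, α)) = 0) ∧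
    (∀ k : ℕ, bB ≤ k → ∀ (L : Fin m) (α : MI n), mdeg α ≤ k →
      ∃ (T : Finset ((Fin m × MI n) →₀ ℕ))
        (c : ((Fin m × MI n) →₀ ℕ) → Jet n m → ℝ),
        (∀ μ ∈ T, ∀ q ∈ μ.support, mdeg q.2 > k) ∧
        (∀ μ ∈ T, Admissible (c μ) ∧ DependsOnOrderLE k (c μ)) ∧
        ∀ p : Jet n m, η (L, α) p =
          ∑ μ ∈ T, c μ p * μ.prod (fun q e => p.2 q ^ e)) := by
  obtain ⟨hξ, hη, hrec⟩ := hLB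
  have hord : ∀ q : Fin m × MI n, bB < mdeg q.2 → q ∉ B := fun q hq hqB =>
    absurd (Finset.le_sup (f := fun q : Fin m × MI n => mdeg q.2) hqB) (by rw [← hbB]; omega)
  have hξB : ∀ i, DependsOnOrderLE bB (ξ i) := fun i => (hξ i).dependsOnOrderLE fun q hq => by
    by_contra h
    exact hord q hq ((hB q).mpr (.inl ⟨i, h⟩))
  have hηB : ∀ L, DependsOnOrderLE bB (η (L, 0)) := fun L =>
    (hη (L, 0)).dependsOnOrderLE fun q hq => by
      by_contra h
      exact hord q hq ((hB q).mpr (.inr ⟨L, h⟩))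
  constructor
  · intro L α M γ hγ
    suffices h : DependsOnOrderLE (mdeg α + bB) (η (L, α)) from h.pdY_eq_zero hγ
    clear hγ
    induction α using MI.induction with
    | zero => exact (hηB L).mono (by omega)
    | step α k ih =>
      rw [hrec, mdeg_add_single]
      intro p p' hx hy
      have hη' := ((ih.totD k).mono (by omega)) p p' hx hy
      have hξ' := fun i => (((hξB i).totD k).mono (by omega)) p p' hx hy
      simp only [hη', hξ']
      congr 1
      refine Finset.sum_congr rfl fun i _ => ?_
      rw [hy _ _ (by rw [mdeg_add_single]; omega)]
  · intro k hk L α _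
    refine exists_polynomial_of_mem_polyAlgebra ?_
    have hξk : ∀ i, ξ i ∈ polyAlgebra n m k := fun i =>
      mem_polyAlgebra_of_low (hξ i) ((hξB i).mono hk)
    clear * - hrec hξk hη hηB hk
    induction α using MI.induction with
    | zero => exact mem_polyAlgebra_of_low (hη _) ((hηB L).mono hk)
    | step α j ih =>
      have : η (L, α + Pi.single j 1) = totD j (η (L, α)) -
          ∑ i, (fun p : Jet n m => p.2 (L, α + Pi.single i 1)) * totD j (ξ i) := by
        rw [hrec]
        funext p
        simp
      rw [this]
      exact sub_mem (totD_mem_polyAlgebra ih j) (sum_mem fun i _ =>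
        mul_mem (coord_mem_polyAlgebra k _) (totD_mem_polyAlgebra (hξk i) j))
end
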